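/- Under assumptions (A1) and (A3–A7), with constant step size γ > 0, for every n ≥ 1 the following refined moment bounds hold, with θ̄_n = (1/n)·Σ_{k=0}^{n−1} θ_k: (i) E[2γn·(f(θ̄_n) − f(θ*)) + ‖θ_n − θ*‖²] ≤ ‖θ_0 − θ*‖² + nγ²R²; (ii) E[(2γn·(f(θ̄_n) − f(θ*)) + ‖θ_n − θ*‖²)²] ≤ (‖θ_0 − θ*‖² + 9nγ²R²)²; and (iii) E[(2γn·(f(θ̄_n) − f(θ*)) + ‖θ_n − θ*‖²)³] ≤ (‖θ_0 − θ*‖² + 20nγ²R²)³. -/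

import Mathlib

open MeasureTheory

open scoped RealInnerProductSpace

/-- Powers of an essentially bounded function are essentially bounded. -/
lemma MeasureTheory.MemLp.pow_top {Ω : Type*} {mΩ : MeasurableSpace Ω} {P : Measure Ω}
    {X : Ω → ℝ} (hX : MemLp X ⊤ P) (k : ℕ) : MemLp (fun ω => X ω ^ k) ⊤ P := by
  induction k with
  | zero => simpa only [pow_zero] using memLp_top_const (1 : ℝ)
  | succ k ih =>
    simp only [pow_succ]
    exact hX.mul' ih

/-- First-order characterisation of convexity: a convex function lies above its tangents. -/
lemma ConvexOn.sub_le_inner_gradient {H : Type*} [NormedAddCommGroup H] [InnerProductSpace ℝ H]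
    [CompleteSpace H] {f : H → ℝ} (hf : ConvexOn ℝ Set.univ f) {x : H}
    (hd : DifferentiableAt ℝ f x) (y : H) :
    f x - f y ≤ ⟪gradient f x, x - y⟫ := by
  have hline : HasDerivAt (AffineMap.lineMap x y : ℝ → H) (y - x) 0 :=
    AffineMap.hasDerivAt_lineMap
  have hfx : HasFDerivAt f (InnerProductSpace.toDual ℝ H (gradient f x))
      (AffineMap.lineMap x y (0 : ℝ)) := by
    simpa using hd.hasGradientAt.hasFDerivAt
  have hconv : ConvexOn ℝ Set.univ (f ∘ (AffineMap.lineMap x y : ℝ →ᵃ[ℝ] H)) := by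
    simpa using hf.comp_affineMap (AffineMap.lineMap x y : ℝ →ᵃ[ℝ] H)
  have hslope := hconv.le_slope_of_hasDerivAt (Set.mem_univ 0) (Set.mem_univ 1) one_pos
    (hfx.comp_hasDerivAt (0 : ℝ) hline)
  simp only [slope, Function.comp_apply, AffineMap.lineMap_apply_zero,
    AffineMap.lineMap_apply_one, InnerProductSpace.toDual_apply_apply, sub_zero, inv_one, one_smul,
    vsub_eq_sub] at hslope
  rw [← neg_sub y x, inner_neg_right]
  linarith

/-- If the conditional mean of `g` has inner product at least `a` with `v`, then the difference
`⟪g, v⟫ - a` has nonnegative integral against nonnegative bounded past-measurable weights. -/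
lemma integral_mul_inner_sub_nonneg {H Ω : Type*} [NormedAddCommGroup H] [InnerProductSpace ℝ H]
    [CompleteSpace H] {m mΩ : MeasurableSpace Ω} {P : Measure Ω} [IsProbabilityMeasure P]
    (hm : m ≤ mΩ) {g G v : Ω → H} {a Z : Ω → ℝ} (hg : MemLp g ⊤ P) (hG : P[g|m] =ᵐ[P] G)
    (hvm : StronglyMeasurable[m] v) (hv : MemLp v ⊤ P) (ha : MemLp a ⊤ P)
    (haG : ∀ᵐ ω ∂P, a ω ≤ ⟪G ω, v ω⟫)
    (hZm : StronglyMeasurable[m] Z) (hZ : MemLp Z ⊤ P) (hZ0 : ∀ ω, 0 ≤ Z ω) :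
    0 ≤ ∫ ω, Z ω * (⟪g ω, v ω⟫ - a ω) ∂P := by
  have hw : MemLp (fun ω => Z ω • v ω) ⊤ P := hv.smul hZ
  have hgi : Integrable g P := hg.integrable le_top
  have hint : Integrable (fun ω => innerSL ℝ (Z ω • v ω) (g ω)) P := by
    refine ((hg.norm.mul' hw.norm).integrable le_top).mono' (hw.1.inner hg.1) ?_
    exact ae_of_all _ fun ω => norm_inner_le_norm _ _
  have hpull : P[fun ω => innerSL ℝ (Z ω • v ω) (g ω)|m]
      =ᵐ[P] fun ω => innerSL ℝ (Z ω • v ω) (P[g|m] ω) :=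
    condExp_bilin_of_stronglyMeasurable_left (innerSL ℝ) (hZm.smul hvm) hint hgi
  have hZa : Integrable (fun ω => Z ω * a ω) P := (ha.mul hZ).integrable le_top
  have hsplit : ∀ ω, Z ω * (⟪g ω, v ω⟫ - a ω) = innerSL ℝ (Z ω • v ω) (g ω) - Z ω * a ω := by
    intro ω
    rw [innerSL_apply_apply, real_inner_smul_left, real_inner_comm]
    ring
  simp_rw [hsplit]
  rw [integral_sub hint hZa, sub_nonneg, ← integral_condExp hm (f := fun ω => innerSL ℝ (Z ω • v ω) (g ω))]
  refine integral_mono_ae hZa integrable_condExp ?_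
  filter_upwards [hpull, hG, haG] with ω h1 h2 h3
  rw [h1, h2, innerSL_apply_apply, real_inner_smul_left, real_inner_comm]
  exact mul_le_mul_of_nonneg_left h3 (hZ0 ω)

/-- One-step moment bounds for a nonnegative variable `B ≤ A + C - δ`, where `δ` has nonnegative
conditional mean and conditional second moment at most `4 * C * A`. -/
lemma moment_step_bounds {Ω : Type*} {m mΩ : MeasurableSpace Ω} {P : Measure Ω}
    [IsProbabilityMeasure P] {A B b δ : Ω → ℝ} {C : ℝ} (hC : 0 ≤ C)
    (hAm : StronglyMeasurable[m] A) (hA : MemLp A ⊤ P) (hA0 : ∀ ω, 0 ≤ A ω)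
    (hB0 : ∀ ω, 0 ≤ B ω)
    (hbm : StronglyMeasurable[m] b) (hb : MemLp b ⊤ P) (hb0 : ∀ ω, 0 ≤ b ω)
    (hδ : MemLp δ ⊤ P)
    (hstep : ∀ᵐ ω ∂P, B ω ≤ A ω + C - δ ω)
    (hsq : ∀ᵐ ω ∂P, δ ω ^ 2 ≤ 4 * C * A ω - 2 * b ω * δ ω)
    (habs : ∀ᵐ ω ∂P, |δ ω| ≤ 2 * (A ω + C))
    (hdrift : ∀ Z : Ω → ℝ, StronglyMeasurable[m] Z → MemLp Z ⊤ P → (∀ ω, 0 ≤ Z ω) →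
      0 ≤ ∫ ω, Z ω * δ ω ∂P) :
    (∫ ω, B ω ∂P ≤ ∫ ω, A ω ∂P + C) ∧
    (∫ ω, B ω ^ 2 ∂P ≤ ∫ ω, A ω ^ 2 ∂P + 6 * C * ∫ ω, A ω ∂P + C ^ 2) ∧
    (∫ ω, B ω ^ 3 ∂P ≤ ∫ ω, A ω ^ 3 ∂P + 23 * C * ∫ ω, A ω ^ 2 ∂P
      + 23 * C ^ 2 * ∫ ω, A ω ∂P + C ^ 3) := by
  have hT : MemLp (fun ω => A ω + C) ⊤ P := hA.add (memLp_const C)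
  have hTm : StronglyMeasurable[m] (fun ω => A ω + C) := hAm.add stronglyMeasurable_const
  have hT0 : ∀ ω, 0 ≤ A ω + C := fun ω => add_nonneg (hA0 ω) hC
  have hA2 : MemLp (fun ω => A ω ^ 2) ⊤ P := hA.pow_top 2
  have hA3 : MemLp (fun ω => A ω ^ 3) ⊤ P := hA.pow_top 3
  have hA1i := hA.integrable (q := ⊤) le_top
  have hA2i := hA2.integrable (q := ⊤) le_top
  have hA3i := hA3.integrable (q := ⊤) le_top
  have hT2 : MemLp (fun ω => (A ω + C) * (A ω + C)) ⊤ P := hT.mul' hT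
  have hTb : MemLp (fun ω => (A ω + C) * b ω) ⊤ P := hb.mul' hT
  have key : ∀ (c₀ c₁ c₂ c₃ : ℝ) (X Z : Ω → ℝ), (∀ ω, 0 ≤ X ω) → StronglyMeasurable[m] Z →
      MemLp Z ⊤ P → (∀ ω, 0 ≤ Z ω) →
      (∀ᵐ ω ∂P, X ω ≤ c₃ * A ω ^ 3 + c₂ * A ω ^ 2 + c₁ * A ω + c₀ - Z ω * δ ω) →
      ∫ ω, X ω ∂P ≤ c₃ * ∫ ω, A ω ^ 3 ∂P + c₂ * ∫ ω, A ω ^ 2 ∂P + c₁ * ∫ ω, A ω ∂P + c₀ := by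
    intro c₀ c₁ c₂ c₃ X Z hX hZm hZ hZ0 hle
    have hZδ : Integrable (fun ω => Z ω * δ ω) P := (hδ.mul' hZ).integrable le_top
    have h3 := hA3i.const_mul c₃
    have h2 := hA2i.const_mul c₂
    have h1 := hA1i.const_mul c₁
    have h32 : Integrable (fun ω => c₃ * A ω ^ 3 + c₂ * A ω ^ 2) P := h3.add h2
    have h321 : Integrable (fun ω => c₃ * A ω ^ 3 + c₂ * A ω ^ 2 + c₁ * A ω) P := h32.add h1
    have h3210 : Integrable (fun ω => c₃ * A ω ^ 3 + c₂ * A ω ^ 2 + c₁ * A ω + c₀) P :=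
      h321.add (integrable_const _)
    have hmono := integral_mono_of_nonneg (ae_of_all _ hX) (h3210.sub hZδ) hle
    simp only [Pi.sub_apply] at hmono
    rw [integral_sub h3210 hZδ, integral_add h321 (integrable_const _), integral_add h32 h1,
      integral_add h3 h2, integral_const_mul, integral_const_mul, integral_const_mul,
      integral_const, probReal_univ, one_smul] at hmono
    linarith [hdrift Z hZm hZ hZ0]
  refine ⟨?_, ?_, ?_⟩
  · have h := key C 1 0 0 B (fun _ => 1) hB0 stronglyMeasurable_const (memLp_const _)
      (fun _ => zero_le_one) (by filter_upwards [hstep] with ω h; linarith)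
    linarith
  · have h := key (C ^ 2) (6 * C) 1 0 (fun ω => B ω ^ 2) (fun ω => 2 * (A ω + C) + 2 * b ω)
      (fun ω => sq_nonneg _) ((hTm.const_mul 2).add (hbm.const_mul 2))
      ((hT.const_mul 2).add (hb.const_mul 2))
      (fun ω => by linarith [hT0 ω, hb0 ω]) (by
        filter_upwards [hstep, hsq] with ω h h2
        have := pow_le_pow_left₀ (hB0 ω) h 2
        linarith)
    linarith
  · have h := key (C ^ 3) (23 * C ^ 2) (23 * C) 1 (fun ω => B ω ^ 3)
      (fun ω => 3 * ((A ω + C) * (A ω + C)) + 10 * ((A ω + C) * b ω))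
      (fun ω => pow_nonneg (hB0 ω) 3)
      (((hTm.mul hTm).const_mul 3).add ((hTm.mul hbm).const_mul 10))
      ((hT2.const_mul 3).add (hTb.const_mul 10))
      (fun ω => by have := hT0 ω; have := hb0 ω; positivity) (by
        filter_upwards [hstep, hsq, habs] with ω h h2 h3
        have hcube := pow_le_pow_left₀ (hB0 ω) h 3
        have hδ3 := mul_le_mul_of_nonneg_right ((neg_le_abs _).trans h3) (sq_nonneg (δ ω))
        have hTδ2 := mul_le_mul_of_nonneg_left h2 (hT0 ω)
        linarith)
    linarith

/-- Moment bounds along a sequence of nonnegative variables with the one-step increments of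
`moment_step_bounds`. -/
lemma moment_bounds {Ω : Type*} {mΩ : MeasurableSpace Ω} {P : Measure Ω}
    [IsProbabilityMeasure P] (ℱ : Filtration ℕ mΩ) {A b δ : ℕ → Ω → ℝ} {C D : ℝ} (hC : 0 ≤ C)
    (hD : 0 ≤ D) (hinit : ∀ ω, A 0 ω = D)
    (hAm : ∀ k, StronglyMeasurable[ℱ k] (A k)) (hA : ∀ k, MemLp (A k) ⊤ P)
    (hA0 : ∀ k ω, 0 ≤ A k ω)
    (hbm : ∀ k, StronglyMeasurable[ℱ k] (b k)) (hb : ∀ k, MemLp (b k) ⊤ P)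
    (hb0 : ∀ k ω, 0 ≤ b k ω) (hδ : ∀ k, MemLp (δ k) ⊤ P)
    (hstep : ∀ k, ∀ᵐ ω ∂P, A (k + 1) ω ≤ A k ω + C - δ k ω)
    (hsq : ∀ k, ∀ᵐ ω ∂P, δ k ω ^ 2 ≤ 4 * C * A k ω - 2 * b k ω * δ k ω)
    (habs : ∀ k, ∀ᵐ ω ∂P, |δ k ω| ≤ 2 * (A k ω + C))
    (hdrift : ∀ k, ∀ Z : Ω → ℝ, StronglyMeasurable[ℱ k] Z → MemLp Z ⊤ P → (∀ ω, 0 ≤ Z ω) →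
      0 ≤ ∫ ω, Z ω * δ k ω ∂P) (n : ℕ) :
    (∫ ω, A n ω ∂P ≤ D + n * C) ∧
    (∫ ω, A n ω ^ 2 ∂P ≤ (D + 9 * n * C) ^ 2) ∧
    (∫ ω, A n ω ^ 3 ∂P ≤ (D + 20 * n * C) ^ 3) := by
  induction n with
  | zero => simp [hinit]
  | succ k ih =>
    obtain ⟨h1, h2, h3⟩ := ih
    obtain ⟨s1, s2, s3⟩ := moment_step_bounds hC (hAm k) (hA k) (hA0 k)
      (hA0 (k + 1)) (hbm k) (hb k) (hb0 k) (hδ k) (hstep k) (hsq k) (habs k) (hdrift k)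
    obtain ⟨K, hK, hk⟩ : ∃ K : ℝ, K = k * C ∧ 0 ≤ K := ⟨k * C, rfl, by positivity⟩
    have e2 : D + 9 * k * C = D + 9 * K := by rw [hK]; ring
    have e3 : D + 20 * k * C = D + 20 * K := by rw [hK]; ring
    have e2' : D + 9 * ((k + 1 : ℕ) : ℝ) * C = D + 9 * K + 9 * C := by rw [hK]; push_cast; ring
    have e3' : D + 20 * ((k + 1 : ℕ) : ℝ) * C = D + 20 * K + 20 * C := by
      rw [hK]; push_cast; ring
    rw [← hK] at h1
    rw [e2] at h2
    rw [e3] at h3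
    rw [e2', e3']
    have h1' := mul_le_mul_of_nonneg_left h1 hC
    have h1'' := mul_le_mul_of_nonneg_left h1' hC
    have h2' := mul_le_mul_of_nonneg_left h2 hC
    refine ⟨?_, ?_, ?_⟩
    · push_cast
      linarith
    · have : 0 ≤ C * D := by positivity
      have : 0 ≤ C * K := by positivity
      linarith [sq_nonneg C]
    · have : 0 ≤ C * D ^ 2 := by positivity
      have : 0 ≤ C * K ^ 2 := by positivity
      have : 0 ≤ C * D * K := by positivity
      have : 0 ≤ C ^ 2 * D := by positivity
      have : 0 ≤ C ^ 2 * K := by positivity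
      have : 0 ≤ C ^ 3 := by positivity
      linarith

theorem bach_small_p_bounds
    {H : Type*} [NormedAddCommGroup H] [InnerProductSpace ℝ H] [CompleteSpace H]
    {Ω : Type*} {mΩ : MeasurableSpace Ω} {P : Measure Ω} [IsProbabilityMeasure P]
    (ℱ : Filtration ℕ mΩ)
    (f : H → ℝ) (F : ℕ → Ω → H → ℝ) (θstar θ0 : H) (R γ : ℝ)
    (θ : ℕ → Ω → H)
    (hR : 0 < R)
    (hγ : 0 < γ)
    -- (A1) convexity and differentiability of f
    (hf_conv : ConvexOn ℝ Set.univ f)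
    (hf_diff : Differentiable ℝ f)
    -- (A3) attained global minimum
    (hmin : ∀ θ' : H, f θstar ≤ f θ')
    -- (A4) Lipschitz-continuity of f and the fₙ
    (hf_grad_bound : ∀ θ' : H, ‖gradient f θ'‖ ≤ R)
    (hF_grad_bound : ∀ n : ℕ, ∀ᵐ ω ∂P, ∀ θ' : H, ‖gradient (F n ω) θ'‖ ≤ R)
    (hF_conv : ∀ n ω, ConvexOn ℝ Set.univ (F n ω))
    (hF_diff : ∀ n ω, Differentiable ℝ (F n ω))
    -- (A5) adapted measurability
    (hF_meas : ∀ n : ℕ, ∀ x : H, StronglyMeasurable[ℱ n] (fun ω => F n ω x))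
    (hθ_adapted : ∀ n : ℕ, StronglyMeasurable[ℱ n] (θ n))
    -- (A6) unbiased gradients
    (hunbiased : ∀ n : ℕ, 1 ≤ n →
      P[(fun ω => gradient (F n ω) (θ (n - 1) ω))|ℱ (n - 1)]
        =ᵐ[P] fun ω => gradient f (θ (n - 1) ω))
    -- (A7) stochastic gradient recursion
    (hθ0 : ∀ ω, θ 0 ω = θ0)
    (hrec : ∀ n : ℕ, 1 ≤ n → ∀ ω,
      θ n ω = θ (n - 1) ω - γ • gradient (F n ω) (θ (n - 1) ω))
    (n : ℕ) (hn : 1 ≤ n)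
    :
    (∫ ω, (2 * γ * n * (f (((n : ℝ))⁻¹ • ∑ k ∈ Finset.range n, θ k ω) - f θstar)
        + ‖θ n ω - θstar‖ ^ 2) ∂P
      ≤ ‖θ0 - θstar‖ ^ 2 + n * γ ^ 2 * R ^ 2) ∧
    (∫ ω, (2 * γ * n * (f (((n : ℝ))⁻¹ • ∑ k ∈ Finset.range n, θ k ω) - f θstar)
        + ‖θ n ω - θstar‖ ^ 2) ^ 2 ∂P
      ≤ (‖θ0 - θstar‖ ^ 2 + 9 * n * γ ^ 2 * R ^ 2) ^ 2) ∧
    (∫ ω, (2 * γ * n * (f (((n : ℝ))⁻¹ • ∑ k ∈ Finset.range n, θ k ω) - f θstar)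
        + ‖θ n ω - θstar‖ ^ 2) ^ 3 ∂P
      ≤ (‖θ0 - θstar‖ ^ 2 + 20 * n * γ ^ 2 * R ^ 2) ^ 3) := by
  have hgap0 : ∀ x, 0 ≤ f x - f θstar := fun x => sub_nonneg.2 (hmin x)
  have hgap_inner : ∀ x, f x - f θstar ≤ ⟪gradient f x, x - θstar⟫ := fun x =>
    hf_conv.sub_le_inner_gradient (hf_diff x) θstar
  have hgap_norm : ∀ x, f x - f θstar ≤ R * ‖x - θstar‖ := fun x =>
    (hgap_inner x).trans ((real_inner_le_norm _ _).trans (by gcongr; exact hf_grad_bound x))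
  let g : ℕ → Ω → H := fun k ω => gradient (F (k + 1) ω) (θ k ω)
  have hrec' : ∀ k ω, θ (k + 1) ω = θ k ω - γ • g k ω := fun k ω => hrec (k + 1) (by omega) ω
  have hg_norm : ∀ k, ∀ᵐ ω ∂P, ‖g k ω‖ ≤ R := fun k => by
    filter_upwards [hF_grad_bound (k + 1)] with ω h using h _
  have hθm : ∀ k, StronglyMeasurable (θ k) := fun k => (hθ_adapted k).mono (ℱ.le k)
  have hg_mem : ∀ k, MemLp (g k) ⊤ P := fun k => by
    have hgk : g k = fun ω => γ⁻¹ • (θ k ω - θ (k + 1) ω) := by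
      funext ω
      rw [hrec', sub_sub_cancel, inv_smul_smul₀ hγ.ne']
    refine memLp_top_of_bound ?_ R (hg_norm k)
    rw [hgk]
    exact (((hθm k).sub (hθm (k + 1))).const_smul γ⁻¹).aestronglyMeasurable
  have hθ_mem : ∀ k, MemLp (θ k) ⊤ P := fun k => by
    induction k with
    | zero => rw [funext hθ0]; exact memLp_const _
    | succ k ih => rw [funext (hrec' k)]; exact ih.sub ((hg_mem k).const_smul γ)
  have hv_mem : ∀ k, MemLp (fun ω => θ k ω - θstar) ⊤ P := fun k =>
    (hθ_mem k).sub (memLp_const _)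
  have hv_meas : ∀ k, StronglyMeasurable[ℱ k] (fun ω => θ k ω - θstar) := fun k =>
    (hθ_adapted k).sub stronglyMeasurable_const
  have ha_meas : ∀ k, StronglyMeasurable[ℱ k] (fun ω => f (θ k ω) - f θstar) := fun k =>
    (hf_diff.continuous.comp_stronglyMeasurable (hθ_adapted k)).sub stronglyMeasurable_const
  have ha_mem : ∀ k, MemLp (fun ω => f (θ k ω) - f θstar) ⊤ P := fun k => by
    refine (hv_mem k).of_le_mul (c := R) ((ha_meas k).mono (ℱ.le k)).aestronglyMeasurable
      (ae_of_all _ fun ω => ?_)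
    rw [Real.norm_of_nonneg (hgap0 _)]
    exact hgap_norm _
  let A : ℕ → Ω → ℝ := fun k ω =>
    2 * γ * ∑ j ∈ Finset.range k, (f (θ j ω) - f θstar) + ‖θ k ω - θstar‖ ^ 2
  let δ : ℕ → Ω → ℝ := fun k ω => 2 * γ * (⟪g k ω, θ k ω - θstar⟫ - (f (θ k ω) - f θstar))
  have hsum0 : ∀ k ω, 0 ≤ ∑ j ∈ Finset.range k, (f (θ j ω) - f θstar) := fun k ω =>
    Finset.sum_nonneg fun j _ => hgap0 _
  have hv_le : ∀ k ω, ‖θ k ω - θstar‖ ^ 2 ≤ A k ω := fun k ω =>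
    le_add_of_nonneg_left (mul_nonneg (by positivity) (hsum0 k ω))
  have hA0 : ∀ k ω, 0 ≤ A k ω := fun k ω => (sq_nonneg _).trans (hv_le k ω)
  have hAm : ∀ k, StronglyMeasurable[ℱ k] (A k) := fun k => by
    refine StronglyMeasurable.add (StronglyMeasurable.const_mul ?_ _) ((hv_meas k).norm.pow 2)
    refine Finset.stronglyMeasurable_fun_sum _ fun j hj => ?_
    exact (ha_meas j).mono (ℱ.mono (Finset.mem_range.1 hj).le)
  have hA_mem : ∀ k, MemLp (A k) ⊤ P := fun k => by
    have hsum : MemLp (fun ω => ∑ j ∈ Finset.range k, (f (θ j ω) - f θstar)) ⊤ P :=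
      memLp_finsetSum _ fun j _ => ha_mem j
    have hsq : MemLp (fun ω => ‖θ k ω - θstar‖ ^ 2) ⊤ P := (hv_mem k).norm.pow_top 2
    exact (hsum.const_mul (2 * γ)).add hsq
  have hu_mem : ∀ k, MemLp (fun ω => ⟪g k ω, θ k ω - θstar⟫) ⊤ P := fun k => by
    refine (hv_mem k).of_le_mul (c := R) ((hg_mem k).1.inner (hv_mem k).1) ?_
    filter_upwards [hg_norm k] with ω h
    exact (norm_inner_le_norm _ _).trans (by gcongr)
  have hδ_mem : ∀ k, MemLp (δ k) ⊤ P := fun k => ((hu_mem k).sub (ha_mem k)).const_mul _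
  have hu_abs : ∀ k, ∀ᵐ ω ∂P, |⟪g k ω, θ k ω - θstar⟫| ≤ R * ‖θ k ω - θstar‖ := fun k => by
    filter_upwards [hg_norm k] with ω h
    exact (abs_real_inner_le_norm _ _).trans (by gcongr)
  have hmom := moment_bounds ℱ (P := P) (A := A) (δ := δ)
    (b := fun k ω => 2 * γ * (f (θ k ω) - f θstar)) (C := γ ^ 2 * R ^ 2)
    (D := ‖θ0 - θstar‖ ^ 2) (by positivity) (by positivity)
    (fun ω => by simp [A, hθ0])
    hAm hA_mem hA0 (fun k => (ha_meas k).const_mul _) (fun k => (ha_mem k).const_mul _)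
    (fun k ω => mul_nonneg (by positivity) (hgap0 _)) hδ_mem
    (fun k => by
      filter_upwards [hg_norm k] with ω h
      have hexp : ‖θ (k + 1) ω - θstar‖ ^ 2 = ‖θ k ω - θstar‖ ^ 2
          - 2 * γ * ⟪g k ω, θ k ω - θstar⟫ + γ ^ 2 * ‖g k ω‖ ^ 2 := by
        rw [hrec', sub_right_comm, norm_sub_sq_real, real_inner_smul_right, norm_smul,
          Real.norm_of_nonneg hγ.le, real_inner_comm]
        ring
      have hg2 : γ ^ 2 * ‖g k ω‖ ^ 2 ≤ γ ^ 2 * R ^ 2 := by gcongr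
      simp only [A, δ, Finset.sum_range_succ, hexp]
      linarith)
    (fun k => by
      filter_upwards [hu_abs k] with ω h
      have hu2 := pow_le_pow_left₀ (abs_nonneg _) h 2
      rw [sq_abs, mul_pow] at hu2
      have hRA := mul_le_mul_of_nonneg_left (hv_le k ω) (sq_nonneg R)
      have hγu := mul_le_mul_of_nonneg_left (hu2.trans hRA) (sq_nonneg γ)
      simp only [δ]
      linarith [mul_nonneg (sq_nonneg γ) (sq_nonneg (f (θ k ω) - f θstar))])
    (fun k => by
      filter_upwards [hu_abs k] with ω h
      have hdiff : |⟪g k ω, θ k ω - θstar⟫ - (f (θ k ω) - f θstar)|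
          ≤ 2 * (R * ‖θ k ω - θstar‖) := by
        refine (abs_sub _ _).trans ?_
        rw [abs_of_nonneg (hgap0 (θ k ω))]
        linarith [hgap_norm (θ k ω)]
      simp only [δ]
      rw [abs_mul, abs_of_pos (by positivity : 0 < 2 * γ)]
      have := mul_le_mul_of_nonneg_left hdiff (by positivity : 0 ≤ 2 * γ)
      linarith [hv_le k ω, sq_nonneg (γ * R - ‖θ k ω - θstar‖)])
    (fun k Z hZm hZ hZ0 => by
      have h := integral_mul_inner_sub_nonneg (ℱ.le k) (hg_mem k)
        (hunbiased (k + 1) (by omega)) (hv_meas k) (hv_mem k) (ha_mem k)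
        (ae_of_all _ fun ω => hgap_inner (θ k ω)) hZm hZ hZ0
      have hcomm : ∀ ω, Z ω * δ k ω
          = 2 * γ * (Z ω * (⟪g k ω, θ k ω - θstar⟫ - (f (θ k ω) - f θstar))) := fun ω => by
        simp only [δ]
        ring
      simp_rw [hcomm]
      rw [integral_const_mul]
      exact mul_nonneg (by positivity) h)
    n
  have hn0 : (0 : ℝ) < n := by exact_mod_cast hn
  have hX0 : ∀ ω, 0 ≤ 2 * γ * n * (f (((n : ℝ))⁻¹ • ∑ k ∈ Finset.range n, θ k ω) - f θstar)
      + ‖θ n ω - θstar‖ ^ 2 := fun ω =>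
    add_nonneg (mul_nonneg (by positivity) (hgap0 _)) (sq_nonneg _)
  have hXA : ∀ ω, 2 * γ * n * (f (((n : ℝ))⁻¹ • ∑ k ∈ Finset.range n, θ k ω) - f θstar)
      + ‖θ n ω - θstar‖ ^ 2 ≤ A n ω := fun ω => by
    have hjensen := hf_conv.map_sum_le (t := Finset.range n) (w := fun _ => (n : ℝ)⁻¹)
      (p := fun k => θ k ω) (fun _ _ => by positivity) (by simp [hn0.ne'])
      (fun _ _ => Set.mem_univ _)
    simp only [smul_eq_mul, ← Finset.smul_sum, ← Finset.mul_sum] at hjensen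
    have hscaled := mul_le_mul_of_nonneg_left hjensen hn0.le
    rw [mul_inv_cancel_left₀ hn0.ne'] at hscaled
    have h2γ := mul_le_mul_of_nonneg_left hscaled (by positivity : 0 ≤ 2 * γ)
    simp only [A, Finset.sum_sub_distrib, Finset.sum_const, Finset.card_range, nsmul_eq_mul]
    linarith
  have hA2 : MemLp (fun ω => A n ω ^ 2) ⊤ P := (hA_mem n).pow_top 2
  have hA3 : MemLp (fun ω => A n ω ^ 3) ⊤ P := (hA_mem n).pow_top 3
  obtain ⟨h1, h2, h3⟩ := hmom
  simp only [← mul_assoc] at h1 h2 h3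
  exact ⟨(integral_mono_of_nonneg (ae_of_all _ hX0) ((hA_mem n).integrable le_top)
      (ae_of_all _ hXA)).trans h1,
    (integral_mono_of_nonneg (ae_of_all _ fun ω => pow_nonneg (hX0 ω) 2) (hA2.integrable le_top)
      (ae_of_all _ fun ω => pow_le_pow_left₀ (hX0 ω) (hXA ω) 2)).trans h2,
    (integral_mono_of_nonneg (ae_of_all _ fun ω => pow_nonneg (hX0 ω) 3) (hA3.integrable le_top)
      (ae_of_all _ fun ω => pow_le_pow_left₀ (hX0 ω) (hXA ω) 3)).trans h3⟩
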